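/- Let I ⊆ ℝ be a compact interval and f : I → I a continuous map. Suppose E ⊆ I is a closed f-invariant subset containing a nondegenerate interval, and the restriction f|_E : E → E is topologically transitive. Then the periodic points of f lying in E are dense in E. -/

import Mathlib

/-- A self-map of a topological space is topologically transitive if for any two
nonempty open sets `U, V` some iterate image of `U` meets `V`. -/
def TopTransitive {Y : Type*} [TopologicalSpace Y] (g : Y → Y) : Prop :=
  ∀ U V : Set Y, IsOpen U → IsOpen V → U.Nonempty → V.Nonempty →
    ∃ n : ℕ, (g^[n] '' U ∩ V).Nonempty

theorem TopTransitive.exists_iterate_mem {α : Type*} [TopologicalSpace α] {f : α → α} {E : Set α}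
    {hE : Set.MapsTo f E E} (h : TopTransitive (Set.MapsTo.restrict f E E hE))
    {U V : Set α} (hU : IsOpen U) (hV : IsOpen V) (hEU : (E ∩ U).Nonempty)
    (hEV : (E ∩ V).Nonempty) : ∃ n : ℕ, ∃ u ∈ E ∩ U, f^[n] u ∈ V := by
  obtain ⟨u, huE, huU⟩ := hEU
  obtain ⟨v, hvE, hvV⟩ := hEV
  obtain ⟨n, _, ⟨w, hwU, rfl⟩, hwV⟩ := h (Subtype.val ⁻¹' U) (Subtype.val ⁻¹' V)
    (hU.preimage continuous_subtype_val) (hV.preimage continuous_subtype_val)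
    ⟨⟨u, huE⟩, huU⟩ ⟨⟨v, hvE⟩, hvV⟩
  rw [Set.MapsTo.iterate_restrict] at hwV
  exact ⟨n, w, ⟨w.2, hwU⟩, hwV⟩

section PeriodicFree

variable {α : Type*} [LinearOrder α] [TopologicalSpace α] [OrderClosedTopology α]
  {f : α → α} {J : Set α}

/-- On a preconnected set without periodic points, the displacement of a fixed positive iterate
has constant sign. -/
theorem IsPreconnected.lt_iterate_of_lt_iterate (hJ : IsPreconnected J) (hf : Continuous f)
    (hper : ∀ x ∈ J, ∀ k : ℕ, 1 ≤ k → f^[k] x ≠ x) {k : ℕ} (hk : 1 ≤ k) {p q : α}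
    (hp : p ∈ J) (hq : q ∈ J) (h : p < f^[k] p) : q < f^[k] q := by
  by_contra! hle
  obtain ⟨r, hr, hrk⟩ := hJ.intermediate_value₂ hp hq continuous_id.continuousOn
    (hf.iterate k).continuousOn h.le hle
  exact hper r hr k hk hrk.symm

theorem IsPreconnected.lt_iterate_mul (hJ : IsPreconnected J) (hf : Continuous f)
    (hper : ∀ x ∈ J, ∀ k : ℕ, 1 ≤ k → f^[k] x ≠ x) {m : ℕ} (hm : 1 ≤ m) {z : α}
    (hz : z ∈ J) (hmz : f^[m] z ∈ J) (h : z < f^[m] z) {k : ℕ} (hk : 1 ≤ k) {q : α}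
    (hq : q ∈ J) : q < f^[m * k] q := by
  refine hJ.lt_iterate_of_lt_iterate hf hper (Nat.mul_pos hm hk) hz hq ?_
  induction k, hk using Nat.le_induction with
  | base => simpa using h
  | succ k hk ih =>
    rw [Nat.mul_succ, Function.iterate_add_apply]
    exact h.trans (hJ.lt_iterate_of_lt_iterate hf hper (Nat.mul_pos hm hk) hz hmz ih)

/-- A preconnected set to which some points return further right and others further left
contains a periodic point. -/
theorem IsPreconnected.exists_periodic_of_returns (hJ : IsPreconnected J) (hf : Continuous f)
    {m n : ℕ} {z w : α} (hz : z ∈ J) (hmz : f^[m] z ∈ J) (hlt : z < f^[m] z)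
    (hw : w ∈ J) (hnw : f^[n] w ∈ J) (hgt : f^[n] w < w) :
    ∃ x ∈ J, ∃ k : ℕ, 1 ≤ k ∧ f^[k] x = x := by
  by_contra! hper
  have hm : 1 ≤ m := Nat.one_le_iff_ne_zero.2 (by rintro rfl; exact hlt.ne rfl)
  have hn : 1 ≤ n := Nat.one_le_iff_ne_zero.2 (by rintro rfl; exact hgt.ne rfl)
  have h₁ : z < f^[m * n] z := hJ.lt_iterate_mul hf hper hm hz hmz hlt hn hz
  have h₂ : f^[n * m] z < z :=
    IsPreconnected.lt_iterate_mul (α := αᵒᵈ) hJ hf hper hn hw hnw hgt hm hz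
  rw [Nat.mul_comm] at h₂
  exact lt_asymm h₁ h₂

end PeriodicFree

theorem Set.OrdConnected.isPreconnected_subtype_Ioo {s : Set ℝ} [s.OrdConnected] (c d : s) :
    IsPreconnected (Set.Ioo c d) := by
  rw [← Topology.IsInducing.subtypeVal.isPreconnected_image]
  refine Set.OrdConnected.isPreconnected ⟨?_⟩
  rintro _ ⟨x, hx, rfl⟩ _ ⟨y, hy, rfl⟩ t ht
  exact ⟨⟨t, Set.OrdConnected.out ‹_› x.2 y.2 ht⟩,
    ⟨lt_of_lt_of_le hx.1 ht.1, lt_of_le_of_lt ht.2 hy.2⟩, rfl⟩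

theorem periodicPts_dense_in_transitive_closed_invariant_set
    (a b : ℝ) (f : Set.Icc a b → Set.Icc a b) (hf : Continuous f)
    (E : Set (Set.Icc a b)) (hEclosed : IsClosed E)
    (hEinv : Set.MapsTo f E E)
    (hndeg : ∃ x y : Set.Icc a b, x < y ∧ Set.Icc x y ⊆ E)
    (htrans : TopTransitive (Set.MapsTo.restrict f E E hEinv)) :
    E ⊆ closure {x | x ∈ E ∧ ∃ k : ℕ, 1 ≤ k ∧ f^[k] x = x} := by
  obtain ⟨x, y, hxy, hE⟩ := hndeg
  have hIoo : Set.Ioo x y ⊆ E := Set.Ioo_subset_Icc_self.trans hE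
  intro p hp
  refine mem_closure_iff.2 fun O hO hpO => ?_
  obtain ⟨v, hv⟩ := exists_between hxy
  obtain ⟨n, u, ⟨-, hu⟩, huO⟩ := htrans.exists_iterate_mem isOpen_Ioo hO ⟨v, hIoo hv, hv⟩
    ⟨p, hp, hpO⟩
  have hnhds : Set.Ioo x y ∩ f^[n] ⁻¹' O ∈ nhds u :=
    (isOpen_Ioo.inter (hO.preimage (hf.iterate n))).mem_nhds ⟨hu, huO⟩
  obtain ⟨c, d, ⟨hcu, hud⟩, hcd⟩ :=
    (mem_nhds_iff_exists_Ioo_subset' ⟨x, hu.1⟩ ⟨y, hu.2⟩).1 hnhds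
  have hleft : Set.Ioo c u ⊆ Set.Ioo c d := Set.Ioo_subset_Ioo_right hud.le
  have hright : Set.Ioo u d ⊆ Set.Ioo c d := Set.Ioo_subset_Ioo_left hcu.le
  have hL : (E ∩ Set.Ioo c u).Nonempty :=
    (exists_between hcu).imp fun t ht => ⟨hIoo (hcd (hleft ht)).1, ht⟩
  have hR : (E ∩ Set.Ioo u d).Nonempty :=
    (exists_between hud).imp fun t ht => ⟨hIoo (hcd (hright ht)).1, ht⟩
  obtain ⟨i, z, ⟨-, hz⟩, hiz⟩ := htrans.exists_iterate_mem isOpen_Ioo isOpen_Ioo hL hR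
  obtain ⟨j, w, ⟨-, hw⟩, hjw⟩ := htrans.exists_iterate_mem isOpen_Ioo isOpen_Ioo hR hL
  obtain ⟨q, hq, k, hk, hkq⟩ :=
    (Set.OrdConnected.isPreconnected_subtype_Ioo c d).exists_periodic_of_returns hf
      (hleft hz) (hright hiz) (hz.2.trans hiz.1) (hright hw) (hleft hjw) (hjw.2.trans hw.1)
  refine ⟨f^[n] q, (hcd hq).2, hEinv.iterate n (hIoo (hcd hq).1), k, hk, ?_⟩
  rw [← Function.iterate_add_apply, Nat.add_comm, Function.iterate_add_apply, hkq]
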